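/- Let e = R_{e₁,e₀} + R_{e₂,e₃} and h = 2·R_{e₁,e₋₁} + R_{e₂,e₋₂} + R_{e₃,e₋₃}, both elements of so(V, β). Then there exists f ∈ so(V, β) such that ⁅h, e⁆ = 2·e, ⁅h, f⁆ = −2·f, and ⁅e, f⁆ = h (so {e, h, f} is an sl(2)-triple in so(V, β)). -/

import Mathlib

noncomputable section

/-- `V = ℂ⁷` with ordered basis `(e₁, e₂, e₃, e₀, e₋₃, e₋₂, e₋₁)`. -/
abbrev V7 : Type := Fin 7 → ℂ

/-- The Gram matrix of the symmetric bilinear form `β` in the ordered basis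
`(e₁, e₂, e₃, e₀, e₋₃, e₋₂, e₋₁)`:  `β(eᵢ, e₋ᵢ) = β(e₋ᵢ, eᵢ) = 1`, `β(e₀,e₀) = 2`,
all other pairs `0`. -/
def Bmat : Matrix (Fin 7) (Fin 7) ℂ :=
  Matrix.of fun i j =>
    if (i : ℕ) + (j : ℕ) = 6 then (if (i : ℕ) = 3 then 2 else 1) else 0

/-- The symmetric bilinear form `β` on `V`. -/
def beta : V7 →ₗ[ℂ] V7 →ₗ[ℂ] ℂ := Matrix.toBilin' Bmat

/-- `so(V, β) = {x ∈ End(V) : β(xu, w) + β(u, xw) = 0 for all u, w}`. -/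
def so7 : Set (Module.End ℂ V7) :=
  {x | ∀ u w : V7, beta (x u) w + beta u (x w) = 0}

/-- `R_{u,w}(v) = β(w,v) • u − β(u,v) • w`. -/
def Rm (u w : V7) : Module.End ℂ V7 :=
  (beta w).smulRight u - (beta u).smulRight w

def e1 : V7 := Pi.single 0 1
def e2 : V7 := Pi.single 1 1
def e3 : V7 := Pi.single 2 1
def e0 : V7 := Pi.single 3 1
def em3 : V7 := Pi.single 4 1
def em2 : V7 := Pi.single 5 1
def em1 : V7 := Pi.single 6 1

/-- The nilpotent element. -/
def eNil : Module.End ℂ V7 := Rm e1 e0 + Rm e2 e3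

/-- The semisimple element. -/
def hSem : Module.End ℂ V7 := (2:ℂ) • Rm e1 em1 + Rm e2 em2 + Rm e3 em3

theorem beta_apply (u w : V7) :
    beta u w = u 0 * w 6 + u 1 * w 5 + u 2 * w 4 + 2 * (u 3 * w 3) + u 4 * w 2 + u 5 * w 1 +
      u 6 * w 0 := by
  simp [beta, Bmat, Matrix.toBilin'_apply, Fin.sum_univ_seven]
  ring

theorem Rm_apply (u w v : V7) : Rm u w v = beta w v • u - beta u v • w := rfl

theorem Rm_mem_so7 (u w : V7) : Rm u w ∈ so7 := by
  intro x y
  simp only [Rm_apply, beta_apply, Pi.sub_apply, Pi.smul_apply, smul_eq_mul]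
  ring

theorem statement10 :
    ∃ f ∈ so7, ⁅hSem, eNil⁆ = (2 : ℂ) • eNil ∧ ⁅hSem, f⁆ = (-2 : ℂ) • f ∧ ⁅eNil, f⁆ = hSem := by
  refine ⟨-(Rm em1 e0 + Rm em2 em3), ?_, ?_, ?_, ?_⟩
  · intro u w
    have h₁ := Rm_mem_so7 em1 e0 u w
    have h₂ := Rm_mem_so7 em2 em3 u w
    simp only [LinearMap.neg_apply, LinearMap.add_apply, map_neg, map_add] at h₁ h₂ ⊢
    linear_combination -h₁ - h₂
  all_goals
    refine LinearMap.ext fun v => funext fun i => ?_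
    fin_cases i <;>
      simp [Ring.lie_def, hSem, eNil, Rm_apply, beta_apply, e1, e2, e3, e0, em1, em2, em3] <;>
      ring
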